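/- arXiv:2010.11277 — 3 statements merged into one kernel-verified Lean document; each statement's English description precedes it below -/
import Mathlib

section
/- Let Ĉ and Ĉ' be finite-dimensional ℤ-graded, ℤ-filtered chain complexes over F₂ that are filtered chain homotopy equivalent. Then for all a, m ∈ ℤ and l ≥ 0, dim ker ι^{Ĉ}(a,m,l)_* = dim ker ι^{Ĉ'}(a,m,l)_*. In particular, the characteristic multisets coincide: Ch(Ĉ) = Ch(Ĉ'). -/
/-!
A finite-dimensional `ℤ`-graded, `ℤ`-filtered chain complex over `F₂ = ZMod 2`,
together with the characteristic-multiset machinery of Chen's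
"An infinite-rank summand from iterated Mazur pattern satellite knots".
-/

/-- A finite-dimensional ℤ-graded, ℤ-filtered chain complex over `F₂`:
a Maslov grading `gr` giving an internal direct sum decomposition, a differential
`d` with `d ∘ d = 0` dropping the grading by one, and an increasing filtration `F`
by subspaces spanned by homogeneous elements, preserved by `d`, exhausting the
complex and eventually zero. -/
structure FCC (V : Type*) [AddCommGroup V] [Module (ZMod 2) V] where
  gr : ℤ → Submodule (ZMod 2) V
  d : V →ₗ[ZMod 2] V
  F : ℤ → Submodule (ZMod 2) V
  internal : DirectSum.IsInternal gr
  d_sq : d ∘ₗ d = 0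
  d_gr : ∀ m : ℤ, (gr m).map d ≤ gr (m - 1)
  F_mono : Monotone F
  F_homog : ∀ k : ℤ, F k = Submodule.span (ZMod 2)
      {x : V | x ∈ F k ∧ ∃ m : ℤ, x ∈ gr m}
  d_F : ∀ k : ℤ, (F k).map d ≤ F k
  F_bot : ∃ N : ℤ, ∀ k ≤ N, F k = ⊥
  F_top : ∃ N : ℤ, ∀ k : ℤ, N ≤ k → F k = ⊤

namespace FCC

variable {V : Type*} [AddCommGroup V] [Module (ZMod 2) V]

/-- The degree-`m` relative cycles of the quotient complex `F a / F (a-1)`: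
elements of `F a` of Maslov grading `m` whose differential lies in `F (a-1)`. -/
def cyc (C : FCC V) (a m : ℤ) : Submodule (ZMod 2) V :=
  C.F a ⊓ C.gr m ⊓ (C.F (a - 1)).comap C.d

/-- The degree-`m` relative boundaries of the quotient complex `F b / F (a-1)`. -/
def bdry (C : FCC V) (b a m : ℤ) : Submodule (ZMod 2) V :=
  (C.F b ⊓ C.gr (m + 1)).map C.d ⊔ (C.F (a - 1) ⊓ C.gr m)

/-- The dimension of the kernel of
`ι(a,m,l)_* : H_m(F_a/F_{a-1}) → H_m(F_{a+l}/F_{a-1})`,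
computed as `dim ((Z ∩ B_{a+l})/B_a)`. -/
noncomputable def kerDim (C : FCC V) (a m : ℤ) (l : ℕ) : ℕ :=
  Module.finrank (ZMod 2) ↥(C.cyc a m ⊓ C.bdry (a + l) a m)
    - Module.finrank (ZMod 2) ↥(C.cyc a m ⊓ C.bdry a a m)

/-- The multiplicity of the triple `(a, m, l)` in the characteristic multiset
`Ch(Ĉ)`, namely `dim ker ι(a,m,l)_* − dim ker ι(a,m,l−1)_*`. -/
noncomputable def mult (C : FCC V) (a m : ℤ) (l : ℕ) : ℕ :=
  C.kerDim a m l - C.kerDim a m (l - 1)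

end FCC


/-- A filtered chain map between ℤ-graded, ℤ-filtered chain complexes over `F₂`:
an `F₂`-linear map commuting with the differentials, preserving the Maslov
grading and the filtration. -/
def IsFilteredChainMap {V W : Type*}
    [AddCommGroup V] [Module (ZMod 2) V] [AddCommGroup W] [Module (ZMod 2) W]
    (C : FCC V) (C' : FCC W) (f : V →ₗ[ZMod 2] W) : Prop :=
  C'.d ∘ₗ f = f ∘ₗ C.d ∧ (∀ m : ℤ, (C.gr m).map f ≤ C'.gr m) ∧
    ∀ k : ℤ, (C.F k).map f ≤ C'.F k

/-- Filtered chain homotopy equivalence of ℤ-graded, ℤ-filtered chain complexes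
over `F₂`: filtered chain maps `f, g` in both directions together with
grading-raising, filtration-preserving homotopies `H, H'` with
`g ∘ f + id = dH + Hd` and `f ∘ g + id = d'H' + H'd'`. -/
def FilteredHomotopyEquiv {V W : Type*}
    [AddCommGroup V] [Module (ZMod 2) V] [AddCommGroup W] [Module (ZMod 2) W]
    (C : FCC V) (C' : FCC W) : Prop :=
  ∃ (f : V →ₗ[ZMod 2] W) (g : W →ₗ[ZMod 2] V)
    (H : V →ₗ[ZMod 2] V) (H' : W →ₗ[ZMod 2] W),
    IsFilteredChainMap C C' f ∧ IsFilteredChainMap C' C g ∧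
    (∀ m : ℤ, (C.gr m).map H ≤ C.gr (m + 1)) ∧
    (∀ k : ℤ, (C.F k).map H ≤ C.F k) ∧
    (∀ m : ℤ, (C'.gr m).map H' ≤ C'.gr (m + 1)) ∧
    (∀ k : ℤ, (C'.F k).map H' ≤ C'.F k) ∧
    g ∘ₗ f + LinearMap.id = C.d ∘ₗ H + H ∘ₗ C.d ∧
    f ∘ₗ g + LinearMap.id = C'.d ∘ₗ H' + H' ∘ₗ C'.d

theorem aux_linalg {V W : Type*}
    [AddCommGroup V] [Module (ZMod 2) V] [FiniteDimensional (ZMod 2) V]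
    [AddCommGroup W] [Module (ZMod 2) W] [FiniteDimensional (ZMod 2) W]
    (f : V →ₗ[ZMod 2] W) (A B : Submodule (ZMod 2) V) (A' B' : Submodule (ZMod 2) W)
    (hB' : B' ≤ A') (h1 : ∀ x ∈ A, f x ∈ A') (h2 : ∀ x ∈ A, f x ∈ B' → x ∈ B) :
    Module.finrank (ZMod 2) A - Module.finrank (ZMod 2) B ≤
      Module.finrank (ZMod 2) A' - Module.finrank (ZMod 2) B' := by
  have e1 := ((B'.mkQ ∘ₗ f).domRestrict A).finrank_range_add_finrank_ker
  have e2 := (B'.mkQ.domRestrict A').finrank_range_add_finrank_ker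
  have k1 : Module.finrank (ZMod 2) (LinearMap.ker ((B'.mkQ ∘ₗ f).domRestrict A)) ≤
      Module.finrank (ZMod 2) B := by
    rw [← Submodule.finrank_map_subtype_eq]
    apply Submodule.finrank_mono
    rintro _ ⟨⟨x, hx⟩, hk, rfl⟩
    apply h2 x hx
    simpa using hk
  have k2 : Module.finrank (ZMod 2) (LinearMap.ker (B'.mkQ.domRestrict A')) =
      Module.finrank (ZMod 2) B' := by
    rw [← Submodule.finrank_map_subtype_eq]
    have : (LinearMap.ker (B'.mkQ.domRestrict A')).map A'.subtype = B' := by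
      ext x
      constructor
      · rintro ⟨⟨y, hy⟩, hk, rfl⟩
        simpa using hk
      · intro hx
        exact ⟨⟨x, hB' hx⟩, by simpa using hx, rfl⟩
    rw [this]
  have k3 : Module.finrank (ZMod 2) (LinearMap.range ((B'.mkQ ∘ₗ f).domRestrict A)) ≤
      Module.finrank (ZMod 2) (LinearMap.range (B'.mkQ.domRestrict A')) := by
    apply Submodule.finrank_mono
    rintro _ ⟨⟨x, hx⟩, rfl⟩
    exact ⟨⟨f x, h1 x hx⟩, rfl⟩
  omega

theorem aux_map_mem {V W : Type*}
    [AddCommGroup V] [Module (ZMod 2) V] [AddCommGroup W] [Module (ZMod 2) W]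
    (C : FCC V) (C' : FCC W) (f : V →ₗ[ZMod 2] W) (hf : IsFilteredChainMap C C' f)
    (a b m : ℤ) (x : V) (hx : x ∈ C.cyc a m ⊓ C.bdry b a m) :
    f x ∈ C'.cyc a m ⊓ C'.bdry b a m := by
  obtain ⟨hd, hg, hF⟩ := hf
  have hd' : ∀ y, C'.d (f y) = f (C.d y) := fun y => LinearMap.congr_fun hd y
  have hg' : ∀ k y, y ∈ C.gr k → f y ∈ C'.gr k := fun k y hy => hg k ⟨y, hy, rfl⟩
  have hF' : ∀ k y, y ∈ C.F k → f y ∈ C'.F k := fun k y hy => hF k ⟨y, hy, rfl⟩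
  obtain ⟨⟨⟨h1, h2⟩, h3⟩, h4⟩ := hx
  refine ⟨⟨⟨hF' _ _ h1, hg' _ _ h2⟩, ?_⟩, ?_⟩
  · change C'.d (f x) ∈ C'.F (a - 1)
    rw [hd']
    exact hF' _ _ h3
  · obtain ⟨_, ⟨y, ⟨hy1, hy2⟩, rfl⟩, z, ⟨hz1, hz2⟩, rfl⟩ := Submodule.mem_sup.1 h4
    rw [map_add, ← hd']
    exact Submodule.mem_sup.2 ⟨_, ⟨f y, ⟨hF' _ _ hy1, hg' _ _ hy2⟩, rfl⟩, _,
      ⟨hF' _ _ hz1, hg' _ _ hz2⟩, rfl⟩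

theorem aux_kerDim_le {V W : Type*}
    [AddCommGroup V] [Module (ZMod 2) V] [FiniteDimensional (ZMod 2) V]
    [AddCommGroup W] [Module (ZMod 2) W] [FiniteDimensional (ZMod 2) W]
    (C : FCC V) (C' : FCC W) (f : V →ₗ[ZMod 2] W) (g : W →ₗ[ZMod 2] V)
    (H : V →ₗ[ZMod 2] V)
    (hf : IsFilteredChainMap C C' f) (hg : IsFilteredChainMap C' C g)
    (hHg : ∀ m : ℤ, (C.gr m).map H ≤ C.gr (m + 1))
    (hHF : ∀ k : ℤ, (C.F k).map H ≤ C.F k)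
    (hH : g ∘ₗ f + LinearMap.id = C.d ∘ₗ H + H ∘ₗ C.d)
    (a m : ℤ) (l : ℕ) : C.kerDim a m l ≤ C'.kerDim a m l := by
  unfold FCC.kerDim
  apply aux_linalg f
  · refine inf_le_inf_left _ (sup_le_sup_right (Submodule.map_mono (inf_le_inf_right _ ?_)) _)
    exact C'.F_mono (by omega)
  · exact fun x hx => aux_map_mem C C' f hf _ _ _ x hx
  · intro x hx hfx
    have hgf := aux_map_mem C' C g hg _ _ _ _ hfx
    refine ⟨hx.1, ?_⟩
    obtain ⟨⟨⟨h1, h2⟩, h3⟩, -⟩ := hx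
    have e : g (f x) + x = C.d (H x) + H (C.d x) := LinearMap.congr_fun hH x
    have hb : C.d (H x) + H (C.d x) ∈ C.bdry a a m := by
      refine Submodule.mem_sup.2 ⟨_, ⟨H x, ⟨hHF _ ⟨x, h1, rfl⟩, hHg _ ⟨x, h2, rfl⟩⟩, rfl⟩, _,
        ⟨hHF _ ⟨_, h3, rfl⟩, ?_⟩, rfl⟩
      have := hHg (m - 1) ⟨_, C.d_gr m ⟨x, h2, rfl⟩, rfl⟩
      simpa using this
    rw [← e] at hb
    exact (Submodule.add_mem_iff_right _ hgf.2).1 hb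

/-- If two finite-dimensional ℤ-graded, ℤ-filtered chain
complexes over `F₂` are filtered chain homotopy equivalent, then for all
`a, m ∈ ℤ` and `l ≥ 0` the kernels of the maps `ι(a,m,l)_*` have the same
dimension; in particular the characteristic multisets coincide:
`Ch(Ĉ) = Ch(Ĉ')`. -/
theorem kerDim_mult_of_filteredHomotopyEquiv {V W : Type*}
    [AddCommGroup V] [Module (ZMod 2) V] [FiniteDimensional (ZMod 2) V]
    [AddCommGroup W] [Module (ZMod 2) W] [FiniteDimensional (ZMod 2) W]
    (C : FCC V) (C' : FCC W) (h : FilteredHomotopyEquiv C C') :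
    (∀ (a m : ℤ) (l : ℕ), C.kerDim a m l = C'.kerDim a m l) ∧
    (∀ (a m : ℤ) (l : ℕ), 1 ≤ l → C.mult a m l = C'.mult a m l) := by
  obtain ⟨f, g, H, H', hf, hg, h1, h2, h3, h4, h5, h6⟩ := h
  have key : ∀ (a m : ℤ) (l : ℕ), C.kerDim a m l = C'.kerDim a m l := fun a m l =>
    le_antisymm (aux_kerDim_le C C' f g H hf hg h1 h2 h5 a m l)
      (aux_kerDim_le C' C g f H' hg hf h3 h4 h6 a m l)
  refine ⟨key, fun a m l _ => ?_⟩
  unfold FCC.mult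
  rw [key, key]
end

section
/- Let Ĉ, Ĉ' and Â be finite-dimensional ℤ-graded, ℤ-filtered chain complexes over F₂, and suppose Ĉ is filtered chain homotopy equivalent to the direct sum Ĉ' ⊕ Â. Then Ch(Ĉ') is contained in Ch(Ĉ) as multisets; that is, for every triple (a,m,l) ∈ ℤ×ℤ×ℤ⁺, the multiplicity of (a,m,l) in Ch(Ĉ') is at most its multiplicity in Ch(Ĉ). -/
theorem aux_finrank {V W : Type*}
    [AddCommGroup V] [Module (ZMod 2) V] [FiniteDimensional (ZMod 2) V]
    [AddCommGroup W] [Module (ZMod 2) W] [FiniteDimensional (ZMod 2) W]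
    (i : W →ₗ[ZMod 2] V) (S T : Submodule (ZMod 2) V) (S' T' : Submodule (ZMod 2) W)
    (hT : T ≤ S) (hS : ∀ x ∈ S', i x ∈ S) (hinj : ∀ x ∈ S', i x ∈ T → x ∈ T') :
    Module.finrank (ZMod 2) S' + Module.finrank (ZMod 2) T
      ≤ Module.finrank (ZMod 2) S + Module.finrank (ZMod 2) T' := by
  have e1 := ((T.mkQ ∘ₗ i).domRestrict S').finrank_range_add_finrank_ker
  have e2 := (T.mkQ.domRestrict S).finrank_range_add_finrank_ker
  have h1 : Module.finrank (ZMod 2) (LinearMap.range ((T.mkQ ∘ₗ i).domRestrict S'))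
      ≤ Module.finrank (ZMod 2) (LinearMap.range (T.mkQ.domRestrict S)) := by
    apply Submodule.finrank_mono
    rintro _ ⟨x, rfl⟩
    exact ⟨⟨i x, hS x x.2⟩, rfl⟩
  have h2 : Module.finrank (ZMod 2) (LinearMap.ker ((T.mkQ ∘ₗ i).domRestrict S'))
      ≤ Module.finrank (ZMod 2) T' := by
    rw [← Submodule.finrank_map_subtype_eq]
    apply Submodule.finrank_mono
    rintro _ ⟨x, hx, rfl⟩
    apply hinj _ x.2
    simpa using hx
  have h3 : Module.finrank (ZMod 2) T
      ≤ Module.finrank (ZMod 2) (LinearMap.ker (T.mkQ.domRestrict S)) := by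
    rw [← Submodule.finrank_map_subtype_eq S (LinearMap.ker (T.mkQ.domRestrict S))]
    apply Submodule.finrank_mono
    intro x hx
    exact ⟨⟨x, hT hx⟩, by simpa using hx, rfl⟩
  omega

theorem aux_bdry_mono {V : Type*} [AddCommGroup V] [Module (ZMod 2) V] (C : FCC V)
    {b c : ℤ} (h : b ≤ c) (a m : ℤ) : C.bdry b a m ≤ C.bdry c a m :=
  sup_le_sup_right (Submodule.map_mono (inf_le_inf_right _ (C.F_mono h))) _

theorem aux_map_cyc {V W : Type*}
    [AddCommGroup V] [Module (ZMod 2) V] [AddCommGroup W] [Module (ZMod 2) W]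
    {C : FCC V} {C' : FCC W} {f : V →ₗ[ZMod 2] W} (h : IsFilteredChainMap C C' f)
    {a m : ℤ} {x : V} (hx : x ∈ C.cyc a m) : f x ∈ C'.cyc a m := by
  obtain ⟨h1, h2, h3⟩ := h
  obtain ⟨⟨hx1, hx2⟩, hx3⟩ := hx
  refine ⟨⟨h3 _ ⟨x, hx1, rfl⟩, h2 _ ⟨x, hx2, rfl⟩⟩, ?_⟩
  have := LinearMap.congr_fun h1 x
  simp only [LinearMap.comp_apply] at this
  change C'.d (f x) ∈ C'.F (a - 1)
  rw [this]
  exact h3 _ ⟨_, hx3, rfl⟩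

theorem aux_map_bdry {V W : Type*}
    [AddCommGroup V] [Module (ZMod 2) V] [AddCommGroup W] [Module (ZMod 2) W]
    {C : FCC V} {C' : FCC W} {f : V →ₗ[ZMod 2] W} (h : IsFilteredChainMap C C' f)
    {b a m : ℤ} {x : V} (hx : x ∈ C.bdry b a m) : f x ∈ C'.bdry b a m := by
  obtain ⟨h1, h2, h3⟩ := h
  obtain ⟨_, ⟨y, ⟨hy1, hy2⟩, rfl⟩, z, ⟨hz1, hz2⟩, rfl⟩ := Submodule.mem_sup.1 hx
  refine Submodule.mem_sup.2 ⟨_, ⟨f y, ⟨h3 _ ⟨y, hy1, rfl⟩, h2 _ ⟨y, hy2, rfl⟩⟩, rfl⟩,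
    f z, ⟨h3 _ ⟨z, hz1, rfl⟩, h2 _ ⟨z, hz2, rfl⟩⟩, ?_⟩
  have := LinearMap.congr_fun h1 y
  simp only [LinearMap.comp_apply] at this
  rw [this, map_add]

theorem aux_mult {V : Type*} [AddCommGroup V] [Module (ZMod 2) V]
    [FiniteDimensional (ZMod 2) V] (C : FCC V) (a m : ℤ) (l : ℕ) :
    C.mult a m l = Module.finrank (ZMod 2) ↥(C.cyc a m ⊓ C.bdry (a + l) a m)
      - Module.finrank (ZMod 2) ↥(C.cyc a m ⊓ C.bdry (a + (l - 1 : ℕ)) a m) := by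
  have : Module.finrank (ZMod 2) ↥(C.cyc a m ⊓ C.bdry a a m) ≤
      Module.finrank (ZMod 2) ↥(C.cyc a m ⊓ C.bdry (a + (l - 1 : ℕ)) a m) :=
    Submodule.finrank_mono (inf_le_inf_left _ (aux_bdry_mono C (by omega) a m))
  unfold FCC.mult FCC.kerDim
  omega

/-- The multiplicity inequality for a filtered homotopy retract. -/
theorem aux_retract {V W : Type*}
    [AddCommGroup V] [Module (ZMod 2) V] [FiniteDimensional (ZMod 2) V]
    [AddCommGroup W] [Module (ZMod 2) W] [FiniteDimensional (ZMod 2) W]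
    (C : FCC V) (C' : FCC W) (i : W →ₗ[ZMod 2] V) (p : V →ₗ[ZMod 2] W)
    (K : W →ₗ[ZMod 2] W) (hi : IsFilteredChainMap C' C i) (hp : IsFilteredChainMap C C' p)
    (hK : ∀ m : ℤ, ∀ x ∈ C'.gr m, K x ∈ C'.gr (m + 1))
    (hKF : ∀ k : ℤ, ∀ x ∈ C'.F k, K x ∈ C'.F k)
    (hpi : ∀ x, p (i x) + x = C'.d (K x) + K (C'.d x)) (a m : ℤ) (l : ℕ) :
    C'.mult a m l ≤ C.mult a m l := by
  rw [aux_mult, aux_mult]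
  have key := aux_finrank i (C.cyc a m ⊓ C.bdry (a + l) a m)
    (C.cyc a m ⊓ C.bdry (a + (l - 1 : ℕ)) a m)
    (C'.cyc a m ⊓ C'.bdry (a + l) a m)
    (C'.cyc a m ⊓ C'.bdry (a + (l - 1 : ℕ)) a m)
    (inf_le_inf_left _ (aux_bdry_mono C (by omega) a m))
    (fun x hx => ⟨aux_map_cyc hi hx.1, aux_map_bdry hi hx.2⟩)
    (by
      rintro x ⟨hx, -⟩ ⟨-, hb⟩
      refine ⟨hx, ?_⟩
      have h1 := aux_map_bdry hp hb
      have h2 : p (i x) + x ∈ C'.bdry (a + (l - 1 : ℕ)) a m := by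
        rw [hpi]
        obtain ⟨⟨hx1, hx2⟩, hx3⟩ := hx
        refine Submodule.add_mem_sup ⟨K x, ⟨?_, hK _ _ hx2⟩, rfl⟩ ⟨hKF _ _ hx3, ?_⟩
        · exact C'.F_mono (by omega) (hKF _ _ hx1)
        · have := hK _ _ (C'.d_gr m ⟨x, hx2, rfl⟩)
          rwa [sub_add_cancel] at this
      simpa using Submodule.sub_mem _ h2 h1)
  omega

/-- If `Ĉ` is filtered chain homotopy equivalent to a direct
sum `Ĉ' ⊕ Â` of finite-dimensional ℤ-graded, ℤ-filtered chain complexes over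
`F₂`, then `Ch(Ĉ') ⊆ Ch(Ĉ)` as multisets: for every triple `(a,m,l)` with
`l ≥ 1`, the multiplicity of `(a,m,l)` in `Ch(Ĉ')` is at most its multiplicity
in `Ch(Ĉ)`. -/
theorem mult_le_of_summand {V W X : Type*}
    [AddCommGroup V] [Module (ZMod 2) V] [FiniteDimensional (ZMod 2) V]
    [AddCommGroup W] [Module (ZMod 2) W] [FiniteDimensional (ZMod 2) W]
    [AddCommGroup X] [Module (ZMod 2) X] [FiniteDimensional (ZMod 2) X]
    (C : FCC V) (C' : FCC W) (A : FCC X) (D : FCC (W × X))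
    (hgr : ∀ m : ℤ, D.gr m = (C'.gr m).prod (A.gr m))
    (hF : ∀ k : ℤ, D.F k = (C'.F k).prod (A.F k))
    (hd : D.d = C'.d.prodMap A.d)
    (h : FilteredHomotopyEquiv C D) :
    ∀ (a m : ℤ) (l : ℕ), 1 ≤ l → C'.mult a m l ≤ C.mult a m l := by
  obtain ⟨f, g, H, H', ⟨f1, f2, f3⟩, ⟨g1, g2, g3⟩, -, -, hH, hHF, -, e⟩ := h
  have inlgr : ∀ m : ℤ, ∀ x ∈ C'.gr m, ((x, 0) : W × X) ∈ D.gr m := by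
    intro m x hx
    rw [hgr]
    exact ⟨hx, Submodule.zero_mem _⟩
  have inlF : ∀ m : ℤ, ∀ x ∈ C'.F m, ((x, 0) : W × X) ∈ D.F m := by
    intro m x hx
    rw [hF]
    exact ⟨hx, Submodule.zero_mem _⟩
  have fstgr : ∀ m : ℤ, ∀ x ∈ D.gr m, x.1 ∈ C'.gr m := by
    intro m x hx
    rw [hgr] at hx
    exact hx.1
  have fstF : ∀ m : ℤ, ∀ x ∈ D.F m, x.1 ∈ C'.F m := by
    intro m x hx
    rw [hF] at hx
    exact hx.1
  have dinl : ∀ x : W, D.d (x, 0) = (C'.d x, 0) := by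
    intro x
    simp [hd]
  have dfst : ∀ x, (D.d x).1 = C'.d x.1 := by
    intro x
    simp [hd]
  intro a m l _
  refine aux_retract C C' (g ∘ₗ LinearMap.inl _ W X) (LinearMap.fst _ W X ∘ₗ f)
    (LinearMap.fst _ W X ∘ₗ H' ∘ₗ LinearMap.inl _ W X) ⟨?_, ?_, ?_⟩ ⟨?_, ?_, ?_⟩ ?_ ?_ ?_ a m l
  · ext x
    have := LinearMap.congr_fun g1 (x, 0)
    simp only [LinearMap.comp_apply, dinl] at this
    simpa using this
  · rintro m _ ⟨x, hx, rfl⟩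
    exact g2 m ⟨_, inlgr m x hx, rfl⟩
  · rintro m _ ⟨x, hx, rfl⟩
    exact g3 m ⟨_, inlF m x hx, rfl⟩
  · ext x
    have := LinearMap.congr_fun f1 x
    simp only [LinearMap.comp_apply] at this
    simp [← this, dfst]
  · rintro m _ ⟨x, hx, rfl⟩
    exact fstgr m _ (f2 m ⟨_, hx, rfl⟩)
  · rintro m _ ⟨x, hx, rfl⟩
    exact fstF m _ (f3 m ⟨_, hx, rfl⟩)
  · intro m x hx
    exact fstgr _ _ (hH m ⟨_, inlgr m x hx, rfl⟩)
  · intro m x hx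
    exact fstF _ _ (hHF m ⟨_, inlF m x hx, rfl⟩)
  · intro x
    have := congrArg Prod.fst (LinearMap.congr_fun e (x, 0))
    simpa [dinl, dfst] using this
end

section
/- Let Ĉ be a finite-dimensional ℤ-graded, ℤ-filtered chain complex over F₂ admitting a basis x_0, x_1, …, x_{2n} and integers A(x_i), M(x_i) (i = 0, …, 2n) such that: for each m ∈ ℤ, Ĉ_m is spanned by {x_i : M(x_i) = m}; for each d ∈ ℤ, F_d is spanned by {x_i : A(x_i) ≤ d}; ∂x_0 = 0; and for each i = 1, …, n one has ∂x_{2i−1} = x_{2i}, ∂x_{2i} = 0, M(x_{2i}) = M(x_{2i−1}) − 1, and l_i := A(x_{2i−1}) − A(x_{2i}) ≥ 1. Then the characteristic multiset of Ĉ is exactly Ch(Ĉ) = {(A(x_{2i}), M(x_{2i}), l_i) : i = 1, …, n}, counted with multiplicity; i.e., for every (a,m,l) ∈ ℤ×ℤ×ℤ⁺, the multiplicity of (a,m,l) in Ch(Ĉ) equals the number of indices i ∈ {1,…,n} with A(x_{2i}) = a, M(x_{2i}) = m and l_i = l. -/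
theorem span_image_inf_aux {V : Type*} [AddCommGroup V] [Module (ZMod 2) V]
    {x : ℕ → V} {U S T : Set ℕ} (h : LinearIndepOn (ZMod 2) x U) (hS : S ⊆ U) (hT : T ⊆ U) :
    Submodule.span (ZMod 2) (x '' S) ⊓ Submodule.span (ZMod 2) (x '' T)
      = Submodule.span (ZMod 2) (x '' (S ∩ T)) := by
  apply le_antisymm
  · rintro y ⟨h1, h2⟩
    obtain ⟨f, hf, rfl⟩ := (Finsupp.mem_span_image_iff_linearCombination _).1 h1
    obtain ⟨g, hg, hfg⟩ := (Finsupp.mem_span_image_iff_linearCombination _).1 h2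
    have hh := linearIndepOn_iffₛ.1 h g (Finsupp.supported_mono hT hg) f
      (Finsupp.supported_mono hS hf) hfg
    subst hh
    refine (Finsupp.mem_span_image_iff_linearCombination _).2 ⟨g, ?_, rfl⟩
    rw [Finsupp.supported_inter]
    exact ⟨hf, hg⟩
  · refine le_inf ?_ ?_
    · exact Submodule.span_mono (Set.image_mono Set.inter_subset_left)
    · exact Submodule.span_mono (Set.image_mono Set.inter_subset_right)

theorem finrank_span_image_aux {V : Type*} [AddCommGroup V] [Module (ZMod 2) V]
    {x : ℕ → V} {U : Set ℕ} (h : LinearIndepOn (ZMod 2) x U) (T : Finset ℕ)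
    (hT : (T : Set ℕ) ⊆ U) :
    Module.finrank (ZMod 2) (Submodule.span (ZMod 2) (x '' (T : Set ℕ))) = T.card := by
  have h1 : LinearIndependent (ZMod 2) (fun i : T => x i) := h.mono hT
  have := finrank_span_eq_card h1
  rw [Fintype.card_coe] at this
  have e : x '' (T : Set ℕ) = Set.range (fun i : T => x i) := by
    ext y
    simp
  rw [e, this]

/-- If a finite-dimensional ℤ-graded, ℤ-filtered chain complex
`Ĉ` over `F₂` admits a vertically simplified basis `x_0, …, x_{2n}` (with Maslov
gradings `M`, Alexander/filtration gradings `A`, `∂x_0 = 0`, and for each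
`i = 1, …, n`: `∂x_{2i−1} = x_{2i}`, `∂x_{2i} = 0`, `M(x_{2i}) = M(x_{2i−1}) − 1`
and arrow length `l_i = A(x_{2i−1}) − A(x_{2i}) ≥ 1`), then the multiplicity of
every triple `(a,m,l)` with `l ≥ 1` in `Ch(Ĉ)` equals the number of indices
`i ∈ {1,…,n}` with `A(x_{2i}) = a`, `M(x_{2i}) = m` and `l_i = l`. -/
theorem mult_of_verticallySimplifiedBasis {V : Type*}
    [AddCommGroup V] [Module (ZMod 2) V] [FiniteDimensional (ZMod 2) V]
    (C : FCC V) (n : ℕ) (x : ℕ → V) (A M : ℕ → ℤ)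
    (hindep : LinearIndependent (ZMod 2) (fun i : Fin (2 * n + 1) => x (i : ℕ)))
    (hspan : Submodule.span (ZMod 2) (x '' {i : ℕ | i ≤ 2 * n}) = ⊤)
    (hgr : ∀ m : ℤ, C.gr m =
      Submodule.span (ZMod 2) (x '' {i : ℕ | i ≤ 2 * n ∧ M i = m}))
    (hF : ∀ k : ℤ, C.F k =
      Submodule.span (ZMod 2) (x '' {i : ℕ | i ≤ 2 * n ∧ A i ≤ k}))
    (hd0 : C.d (x 0) = 0)
    (hdodd : ∀ i : ℕ, 1 ≤ i → i ≤ n → C.d (x (2 * i - 1)) = x (2 * i))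
    (hdeven : ∀ i : ℕ, 1 ≤ i → i ≤ n → C.d (x (2 * i)) = 0)
    (hM : ∀ i : ℕ, 1 ≤ i → i ≤ n → M (2 * i) = M (2 * i - 1) - 1)
    (hlen : ∀ i : ℕ, 1 ≤ i → i ≤ n → 1 ≤ A (2 * i - 1) - A (2 * i)) :
    ∀ (a m : ℤ) (l : ℕ), 1 ≤ l →
      C.mult a m l = ((Finset.Icc 1 n).filter
        (fun i => A (2 * i) = a ∧ M (2 * i) = m ∧
          A (2 * i - 1) - A (2 * i) = (l : ℤ))).card := by
  intro a m l hl
  have hU : LinearIndepOn (ZMod 2) x {i : ℕ | i ≤ 2 * n} := by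
    have e : {i : ℕ | i ≤ 2 * n} = Set.range (fun i : Fin (2 * n + 1) => (i : ℕ)) := by
      ext i
      simp only [Set.mem_ofPred_eq, Set.mem_range]
      exact ⟨fun hi => ⟨⟨i, by omega⟩, rfl⟩, by rintro ⟨j, rfl⟩; have := j.2; omega⟩
    rw [e]
    exact (linearIndepOn_range_iff Fin.val_injective x).2 hindep
  -- intersection of filtration and grading
  have hFg : ∀ k m : ℤ, C.F k ⊓ C.gr m =
      Submodule.span (ZMod 2) (x '' {i : ℕ | i ≤ 2 * n ∧ A i ≤ k ∧ M i = m}) := by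
    intro k m
    rw [hF, hgr, span_image_inf_aux hU (fun i hi => hi.1) (fun i hi => hi.1)]
    congr 2
    ext i
    simp only [Set.mem_inter_iff, Set.mem_ofPred_eq]
    tauto
  have hmap : ∀ b : ℤ, (C.F b ⊓ C.gr (m + 1)).map C.d = Submodule.span (ZMod 2)
      (x '' {j : ℕ | ∃ i, 1 ≤ i ∧ i ≤ n ∧ j = 2 * i ∧ A (2 * i - 1) ≤ b ∧ M (2 * i) = m}) := by
    intro b
    rw [hFg, Submodule.map_span]
    apply le_antisymm
    · rw [Submodule.span_le]
      rintro _ ⟨_, ⟨j, ⟨hj, hjA, hjM⟩, rfl⟩, rfl⟩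
      rcases Nat.even_or_odd' j with ⟨i, rfl | rfl⟩
      · have : C.d (x (2 * i)) = 0 := by
          rcases Nat.eq_zero_or_pos i with rfl | hi
          · simpa using hd0
          · exact hdeven i hi (by omega)
        rw [this]
        exact Submodule.zero_mem _
      · have e : 2 * (i + 1) - 1 = 2 * i + 1 := by omega
        have h1 := hdodd (i + 1) (by omega) (by omega)
        have h2 := hM (i + 1) (by omega) (by omega)
        rw [e] at h1 h2
        rw [h1]
        apply Submodule.subset_span
        refine ⟨_, ⟨i + 1, by omega, by omega, rfl, by rwa [e], by omega⟩, rfl⟩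
    · rw [Submodule.span_le]
      rintro _ ⟨_, ⟨i, h1, h2, rfl, h3, h4⟩, rfl⟩
      apply Submodule.subset_span
      have := hM i h1 h2
      exact ⟨_, ⟨2 * i - 1, ⟨by omega, h3, by omega⟩, rfl⟩, hdodd i h1 h2⟩
  have hcb : ∀ b : ℤ, C.cyc a m ⊓ C.bdry b a m = (C.F a ⊓ C.gr m) ⊓ C.bdry b a m := by
    intro b
    have h1 : C.bdry b a m ≤ (C.F (a - 1)).comap C.d := by
      refine sup_le ?_ ?_
      · rintro _ ⟨y, _, rfl⟩
        have h0 : C.d (C.d y) = 0 := LinearMap.congr_fun C.d_sq y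
        rw [Submodule.mem_comap, h0]
        exact Submodule.zero_mem _
      · exact inf_le_left.trans (Submodule.map_le_iff_le_comap.1 (C.d_F (a - 1)))
    unfold FCC.cyc
    rw [inf_assoc, inf_eq_right.2 h1]
  let P : Finset ℕ := (Finset.range (2 * n + 1)).filter (fun j => A j ≤ a - 1 ∧ M j = m)
  let Q : ℤ → Finset ℕ := fun b => (Finset.Icc 1 n).filter
    (fun i => A (2 * i) = a ∧ M (2 * i) = m ∧ A (2 * i - 1) ≤ b)
  have hrank : ∀ b : ℤ, Module.finrank (ZMod 2) ↥(C.cyc a m ⊓ C.bdry b a m)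
      = P.card + (Q b).card := by
    intro b
    have hcard : (P ∪ (Q b).image (fun i => 2 * i)).card = P.card + (Q b).card := by
      rw [Finset.card_union_of_disjoint, Finset.card_image_of_injective]
      · intro i j hij
        simpa using hij
      · rw [Finset.disjoint_left]
        intro j hj hj2
        simp only [P, Q, Finset.mem_filter, Finset.mem_image] at hj hj2
        obtain ⟨i, hi, rfl⟩ := hj2
        omega
    rw [← hcard, ← finrank_span_image_aux hU]
    · have hset : C.cyc a m ⊓ C.bdry b a m = Submodule.span (ZMod 2)
          (x '' ((P ∪ (Q b).image (fun i => 2 * i) : Finset ℕ) : Set ℕ)) := by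
        rw [hcb, FCC.bdry, hmap, hFg, hFg, ← Submodule.span_union, ← Set.image_union,
          span_image_inf_aux hU (fun i hi => hi.1)]
        · congr 2
          ext j
          simp only [P, Q, Set.mem_inter_iff, Set.mem_union, Set.mem_ofPred_eq, Finset.mem_coe,
            Finset.mem_union, Finset.mem_filter, Finset.mem_image, Finset.mem_range,
            Finset.mem_Icc]
          constructor
          · rintro ⟨⟨h1, h2, h3⟩, ⟨i, h4, h5, rfl, h6, h7⟩ | ⟨h4, h5, h6⟩⟩
            · by_cases h : A (2 * i) = a
              · exact Or.inr ⟨i, ⟨⟨h4, h5⟩, h, h7, h6⟩, rfl⟩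
              · exact Or.inl ⟨by omega, by omega, h7⟩
            · exact Or.inl ⟨by omega, h5, h6⟩
          · rintro (⟨h1, h2, h3⟩ | ⟨i, ⟨⟨h4, h5⟩, h, h7, h6⟩, rfl⟩)
            · exact ⟨⟨by omega, by omega, h3⟩, Or.inr ⟨by omega, h2, h3⟩⟩
            · exact ⟨⟨by omega, by omega, h7⟩, Or.inl ⟨i, h4, h5, rfl, h6, h7⟩⟩
        · rintro j (⟨i, h4, h5, rfl, h6, h7⟩ | ⟨h4, h5, h6⟩)
          · simp only [Set.mem_ofPred_eq]
            omega
          · exact h4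
      rw [hset]
    · intro j hj
      simp only [P, Q, Finset.mem_coe, Finset.mem_union, Finset.mem_filter, Finset.mem_image,
        Finset.mem_range, Finset.mem_Icc] at hj
      simp only [Set.mem_ofPred_eq]
      rcases hj with hj | ⟨i, hi, rfl⟩ <;> omega
  have hQ0 : (Q a).card = 0 := by
    rw [Finset.card_eq_zero, Finset.filter_eq_empty_iff]
    intro i hi hc
    rw [Finset.mem_Icc] at hi
    have := hlen i hi.1 hi.2
    omega
  have hker : ∀ l : ℕ, C.kerDim a m l = (Q (a + l)).card := by
    intro l
    rw [FCC.kerDim, hrank, hrank, hQ0]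
    omega
  rw [FCC.mult, hker, hker]
  have hun : Q (a + l) = Q (a + ((l - 1 : ℕ) : ℤ)) ∪ (Finset.Icc 1 n).filter
        (fun i => A (2 * i) = a ∧ M (2 * i) = m ∧
          A (2 * i - 1) - A (2 * i) = (l : ℤ)) := by
    ext i
    simp only [Q, Finset.mem_union, Finset.mem_filter]
    by_cases hi : i ∈ Finset.Icc 1 n
    · simp only [hi, true_and]
      omega
    · simp [hi]
  rw [hun, Finset.card_union_of_disjoint]
  · omega
  · rw [Finset.disjoint_left]
    intro i h1 h2
    simp only [Q, Finset.mem_filter] at h1 h2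
    omega
end
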